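/- Let 𝒳 and 𝒴 be finite sets with |𝒳| ≥ 2 and |𝒴| ≥ 2, let n ∈ ℕ₊, W ∈ 𝒫(𝒴|𝒳), let 𝐗 be a random variable on 𝒳^n and 𝐘 an output of 𝐗 through W^n. Let U be a finitely supported random variable with U ⊸ 𝐗 ⊸ 𝐘, fix a value u with P(U=u) > 0, and let A_u ⊆ 𝒳^n be the support of the conditional distribution of 𝐗 given U=u. If g^n_W(A_u, 1−β) ≤ 2^c for some c ≥ 0 and β ∈ (0,1), then for every μ > 0: Pr( h(𝐘|U) ≤ μ + c | U=u ) ≥ 1 − 2^{−μ} − β. -/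

import Mathlib

open scoped Classical BigOperators

noncomputable section

namespace Paper

variable {Ω : Type*}

/-- Probability of an event under a discrete probability distribution. -/
def pr (μ : PMF Ω) (E : Set Ω) : ℝ := (μ.toOuterMeasure E).toReal

/-- Conditional probability `Pr(E | F)`. -/
def cpr (μ : PMF Ω) (E F : Set Ω) : ℝ := pr μ (E ∩ F) / pr μ F

/-- Entropy spectrum frequency `h_X(x) = -log₂ Pr(X = x)`. -/
def hs {α : Type*} (μ : PMF Ω) (X : Ω → α) (x : α) : ℝ :=
  - Real.logb 2 (pr μ {ω | X ω = x})

/-- Conditional entropy spectrum frequency `h_{X|Y}(x|y) = -log₂ Pr(X = x | Y = y)`. -/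
def hcs {α β : Type*} (μ : PMF Ω) (X : Ω → α) (Y : Ω → β) (x : α) (y : β) : ℝ :=
  - Real.logb 2 (cpr μ {ω | X ω = x} {ω | Y ω = y})

/-- Conditional Shannon entropy (bits) `H(X|Y)`. -/
def Hc {α β : Type*} [Fintype α] [Fintype β] (μ : PMF Ω) (X : Ω → α) (Y : Ω → β) : ℝ :=
  - ∑ x : α, ∑ y : β, pr μ ({ω | X ω = x} ∩ {ω | Y ω = y}) *
      Real.logb 2 (cpr μ {ω | X ω = x} {ω | Y ω = y})

/-- Shannon entropy (bits) of `X` conditioned on the event `E`. -/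
def HEvt {α : Type*} [Fintype α] (μ : PMF Ω) (X : Ω → α) (E : Set Ω) : ℝ :=
  - ∑ x : α, cpr μ {ω | X ω = x} E * Real.logb 2 (cpr μ {ω | X ω = x} E)

/-- Conditional Shannon entropy (bits) `H(X|Y)` computed given the event `E`. -/
def HcEvt {α β : Type*} [Fintype α] [Fintype β] (μ : PMF Ω) (X : Ω → α) (Y : Ω → β)
    (E : Set Ω) : ℝ :=
  - ∑ x : α, ∑ y : β, cpr μ ({ω | X ω = x} ∩ {ω | Y ω = y}) E *
      Real.logb 2 (cpr μ {ω | X ω = x} ({ω | Y ω = y} ∩ E))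

/-- `A ⊸ B ⊸ C` : `A` and `C` are conditionally independent given `B`. -/
def Markov {α β γ : Type*} (μ : PMF Ω) (A : Ω → α) (B : Ω → β) (C : Ω → γ) : Prop :=
  ∀ a b c, pr μ {ω | A ω = a ∧ B ω = b ∧ C ω = c} * pr μ {ω | B ω = b} =
    pr μ {ω | A ω = a ∧ B ω = b} * pr μ {ω | B ω = b ∧ C ω = c}

/-- A discrete memoryless channel from `𝒳` to `𝒴`. -/
structure Channel (𝒳 𝒴 : Type*) [Fintype 𝒴] where
  w : 𝒳 → 𝒴 → ℝ
  nonneg : ∀ x y, 0 ≤ w x y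
  sum_one : ∀ x, ∑ y, w x y = 1

/-- The `n`-fold product channel `W^n(𝐲|𝐱)`. -/
def Channel.pn {𝒳 𝒴 : Type*} [Fintype 𝒴] (W : Channel 𝒳 𝒴) (n : ℕ)
    (x : Fin n → 𝒳) (y : Fin n → 𝒴) : ℝ := ∏ i, W.w (x i) (y i)

/-- `Y` is an output of `X` through `W^n`. -/
def IsOutput {𝒳 𝒴 : Type*} [Fintype 𝒴] {n : ℕ} (μ : PMF Ω)
    (X : Ω → Fin n → 𝒳) (Y : Ω → Fin n → 𝒴) (W : Channel 𝒳 𝒴) : Prop :=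
  ∀ x y, 0 < pr μ {ω | X ω = x} → cpr μ {ω | Y ω = y} {ω | X ω = x} = W.pn n x y

/-- `W^n(B|𝐱)`. -/
def imgMass {𝒳 𝒴 : Type*} [Fintype 𝒴] (W : Channel 𝒳 𝒴) (n : ℕ)
    (x : Fin n → 𝒳) (B : Finset (Fin n → 𝒴)) : ℝ := ∑ y ∈ B, W.pn n x y

/-- `B` is an `η`-image of `A` by `W`. -/
def IsImage {𝒳 𝒴 : Type*} [Fintype 𝒴] (W : Channel 𝒳 𝒴) (n : ℕ)
    (A : Set (Fin n → 𝒳)) (η : ℝ) (B : Finset (Fin n → 𝒴)) : Prop :=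
  ∀ x ∈ A, η ≤ imgMass W n x B

/-- Minimum cardinality of an `η`-image of `A` by `W`. -/
def gimg {𝒳 𝒴 : Type*} [Fintype 𝒴] (W : Channel 𝒳 𝒴) (n : ℕ)
    (A : Set (Fin n → 𝒳)) (η : ℝ) : ℕ :=
  sInf {k | ∃ B : Finset (Fin n → 𝒴), IsImage W n A η B ∧ B.card = k}

/-- `B` is an `η`-quasi-image of the pmf `P` by `W`. -/
def IsQImage {𝒳 𝒴 : Type*} [Fintype 𝒳] [Fintype 𝒴] (W : Channel 𝒳 𝒴) (n : ℕ)
    (P : (Fin n → 𝒳) → ℝ) (η : ℝ) (B : Finset (Fin n → 𝒴)) : Prop :=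
  η ≤ ∑ x, imgMass W n x B * P x

/-- Minimum cardinality of an `η`-quasi-image of `P` by `W`. -/
def gqimg {𝒳 𝒴 : Type*} [Fintype 𝒳] [Fintype 𝒴] (W : Channel 𝒳 𝒴) (n : ℕ)
    (P : (Fin n → 𝒳) → ℝ) (η : ℝ) : ℕ :=
  sInf {k | ∃ B : Finset (Fin n → 𝒴), IsQImage W n P η B ∧ B.card = k}

/-- The number of values in the support of `U`. -/
def suppCard {α : Type*} [Fintype α] (μ : PMF Ω) (U : Ω → α) : ℕ :=
  (Finset.univ.filter (fun u => 0 < pr μ {ω | U ω = u})).card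

/-- Mutual information (bits). -/
def MI {α β : Type*} [Fintype α] [Fintype β] (μ : PMF Ω) (A : Ω → α) (B : Ω → β) : ℝ :=
  ∑ a : α, ∑ b : β, pr μ {ω | A ω = a ∧ B ω = b} *
    Real.logb 2 (pr μ {ω | A ω = a ∧ B ω = b} / (pr μ {ω | A ω = a} * pr μ {ω | B ω = b}))

/-- Conditional mutual information (bits). -/
def CMI {α β γ : Type*} [Fintype α] [Fintype β] [Fintype γ] (μ : PMF Ω)
    (A : Ω → α) (B : Ω → β) (C : Ω → γ) : ℝ :=
  ∑ c : γ, pr μ {ω | C ω = c} * ∑ a : α, ∑ b : β,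
    cpr μ {ω | A ω = a ∧ B ω = b} {ω | C ω = c} *
      Real.logb 2 (cpr μ {ω | A ω = a ∧ B ω = b} {ω | C ω = c} /
        (cpr μ {ω | A ω = a} {ω | C ω = c} * cpr μ {ω | B ω = b} {ω | C ω = c}))

/-- `D_{wh}(w‖w'|p̂)` in the extended reals, with the stated conventions. -/
def Dkl {𝒳 𝒴 : Type*} [Fintype 𝒳] [Fintype 𝒴] (w w' wh : Channel 𝒳 𝒴)
    (p : 𝒳 → ℝ) : EReal :=
  if ∃ x y, 0 < wh.w x y * p x ∧ w'.w x y = 0 ∧ 0 < w.w x y then ⊤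
  else if ∃ x y, 0 < wh.w x y * p x ∧ w.w x y = 0 ∧ 0 < w'.w x y then ⊥
  else ((∑ x : 𝒳, ∑ y : 𝒴, wh.w x y * p x * Real.logb 2 (w.w x y / w'.w x y) : ℝ) : EReal)

/-- `sup { D_{wh}(w‖w'|p̂) }` over channels `wh` and pmfs `p̂` on `𝒳`. -/
def DklSup {𝒳 𝒴 : Type*} [Fintype 𝒳] [Fintype 𝒴] (w w' : Channel 𝒳 𝒴) : EReal :=
  sSup {d : EReal | ∃ (wh : Channel 𝒳 𝒴) (p : 𝒳 → ℝ),
    (∀ x, 0 ≤ p x) ∧ (∑ x, p x = 1) ∧ d = Dkl w w' wh p}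


lemma pr_nonneg (μ : PMF Ω) (E : Set Ω) : 0 ≤ pr μ E := ENNReal.toReal_nonneg

lemma pr_eq_toMeasure_real (μ : PMF Ω) (E : Set Ω) :
    pr μ E = (@PMF.toMeasure Ω ⊤ μ).real E := by
  let : MeasurableSpace Ω := ⊤
  rw [pr, MeasureTheory.measureReal_def,
    PMF.toMeasure_apply_eq_toOuterMeasure_apply μ (MeasurableSpace.measurableSet_top)]

lemma pr_mono (μ : PMF Ω) {E F : Set Ω} (h : E ⊆ F) : pr μ E ≤ pr μ F := by
  let : MeasurableSpace Ω := ⊤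
  rw [pr_eq_toMeasure_real, pr_eq_toMeasure_real]
  exact MeasureTheory.measureReal_mono h

lemma pr_inter_preimage_finset (μ : PMF Ω) {α : Type*} (f : Ω → α) (E : Set Ω) (B : Finset α) :
    pr μ (E ∩ {ω | f ω ∈ B}) = ∑ y ∈ B, pr μ (E ∩ {ω | f ω = y}) := by
  let : MeasurableSpace Ω := ⊤
  simp only [pr_eq_toMeasure_real]
  rw [← MeasureTheory.measureReal_biUnion_finset]
  · congr 1
    ext ω
    simp
  · intro a _ b _ hab
    refine Set.disjoint_left.2 ?_
    rintro ω ⟨_, ha⟩ ⟨_, hb⟩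
    exact hab (ha.symm.trans hb)
  · exact fun _ _ => MeasurableSpace.measurableSet_top

lemma pr_eq_sum_inter (μ : PMF Ω) {α : Type*} [Fintype α] (f : Ω → α) (E : Set Ω) :
    pr μ E = ∑ y, pr μ (E ∩ {ω | f ω = y}) := by
  simpa using pr_inter_preimage_finset μ f E Finset.univ

lemma cpr_nonneg (μ : PMF Ω) (E F : Set Ω) : 0 ≤ cpr μ E F :=
  div_nonneg (pr_nonneg μ _) (pr_nonneg μ F)

lemma Channel.sum_pn {𝒳 𝒴 : Type*} [Fintype 𝒴] (W : Channel 𝒳 𝒴) (n : ℕ) (x : Fin n → 𝒳) :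
    ∑ y, W.pn n x y = 1 := by
  simp only [Channel.pn]
  rw [← Fintype.prod_sum (fun i y => W.w (x i) y)]
  simp [W.sum_one]

lemma exists_isImage_card_eq_gimg {𝒳 𝒴 : Type*} [Fintype 𝒴] (W : Channel 𝒳 𝒴) (n : ℕ)
    (A : Set (Fin n → 𝒳)) {η : ℝ} (hη : η ≤ 1) :
    ∃ B : Finset (Fin n → 𝒴), IsImage W n A η B ∧ B.card = gimg W n A η := by
  have hne : {k | ∃ B : Finset (Fin n → 𝒴), IsImage W n A η B ∧ B.card = k}.Nonempty :=
    ⟨_, Finset.univ, fun x _ => by rwa [imgMass, W.sum_pn], rfl⟩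
  exact Nat.sInf_mem hne

lemma pr_inter_eq_mul_pn {𝒳 𝒴 𝒰 : Type*} [Fintype 𝒴] {n : ℕ} {W : Channel 𝒳 𝒴} {μ : PMF Ω}
    {X : Ω → Fin n → 𝒳} {Y : Ω → Fin n → 𝒴} {U : Ω → 𝒰} (hout : IsOutput μ X Y W)
    (hmc : Markov μ U X Y) (u : 𝒰) (x : Fin n → 𝒳) (y : Fin n → 𝒴)
    (hx : 0 < pr μ {ω | X ω = x}) :
    pr μ ({ω | U ω = u} ∩ {ω | X ω = x} ∩ {ω | Y ω = y}) =
      pr μ ({ω | U ω = u} ∩ {ω | X ω = x}) * W.pn n x y := by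
  have h := hmc u x y
  have hset : {ω | X ω = x ∧ Y ω = y} = {ω | Y ω = y} ∩ {ω | X ω = x} :=
    Set.inter_comm {ω | X ω = x} {ω | Y ω = y}
  have hset' : {ω | U ω = u ∧ X ω = x ∧ Y ω = y} =
      {ω | U ω = u} ∩ {ω | X ω = x} ∩ {ω | Y ω = y} :=
    (Set.inter_assoc {ω | U ω = u} {ω | X ω = x} {ω | Y ω = y}).symm
  rw [hset, hset', Set.ofPred_and] at h
  rw [← hout x y hx, cpr, ← mul_div_assoc, eq_div_iff hx.ne', h]

/-- An `η`-image of the support of `X` given `U = u` has conditional output probability at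
least `η`. -/
lemma IsImage.mul_pr_le {𝒳 𝒴 𝒰 : Type*} [Fintype 𝒳] [Fintype 𝒴] {n : ℕ} {W : Channel 𝒳 𝒴}
    {μ : PMF Ω} {X : Ω → Fin n → 𝒳} {Y : Ω → Fin n → 𝒴} {U : Ω → 𝒰}
    (hout : IsOutput μ X Y W) (hmc : Markov μ U X Y) {u : 𝒰} {η : ℝ}
    {B : Finset (Fin n → 𝒴)}
    (hB : IsImage W n {x | 0 < cpr μ {ω | X ω = x} {ω | U ω = u}} η B) :
    η * pr μ {ω | U ω = u} ≤ pr μ ({ω | U ω = u} ∩ {ω | Y ω ∈ B}) := by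
  rw [pr_eq_sum_inter μ X {ω | U ω = u}, pr_eq_sum_inter μ X (_ ∩ _), Finset.mul_sum]
  refine Finset.sum_le_sum fun x _ => ?_
  rw [Set.inter_right_comm]
  rcases (pr_nonneg μ ({ω | U ω = u} ∩ {ω | X ω = x})).eq_or_lt with h0 | hpos
  · rw [← h0, mul_zero]
    exact pr_nonneg _ _
  · have hx := hpos.trans_le (pr_mono μ Set.inter_subset_right)
    have hu := hpos.trans_le (pr_mono μ Set.inter_subset_left)
    have hη : η ≤ imgMass W n x B := hB x (by
      rw [Set.mem_ofPred_eq, cpr, Set.inter_comm]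
      exact div_pos hpos hu)
    rw [pr_inter_preimage_finset,
      Finset.sum_congr rfl fun y _ => pr_inter_eq_mul_pn hout hmc u x y hx,
      ← Finset.mul_sum, mul_comm]
    exact mul_le_mul_of_nonneg_left hη hpos.le

lemma cpr_le_of_lt_hcs {α β : Type*} (μ : PMF Ω) (Y : Ω → α) (U : Ω → β) {y : α} {u : β} {t : ℝ}
    (h : t < hcs μ Y U y u) : cpr μ {ω | Y ω = y} {ω | U ω = u} ≤ 2 ^ (-t) := by
  rcases (cpr_nonneg μ {ω | Y ω = y} {ω | U ω = u}).eq_or_lt with h0 | hpos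
  · rw [← h0]
    positivity
  · rw [hcs] at h
    exact ((Real.logb_lt_iff_lt_rpow one_lt_two hpos).1 (by linarith)).le

/-- A small set `B` captures little probability outside the low-spectrum event. -/
lemma pr_inter_mem_le {α β : Type*} (μ : PMF Ω) (Y : Ω → α) (U : Ω → β) {u : β}
    (hu : 0 < pr μ {ω | U ω = u}) (B : Finset α) (t : ℝ) :
    pr μ ({ω | U ω = u} ∩ {ω | Y ω ∈ B}) ≤
      pr μ ({ω | hcs μ Y U (Y ω) (U ω) ≤ t} ∩ {ω | U ω = u}) +
        B.card * 2 ^ (-t) * pr μ {ω | U ω = u} := by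
  rw [pr_inter_preimage_finset,
    ← Finset.sum_filter_add_sum_filter_not B (fun y => hcs μ Y U y u ≤ t)]
  refine add_le_add ?_ ?_
  · rw [← pr_inter_preimage_finset]
    refine pr_mono μ ?_
    rintro ω ⟨rfl, hω⟩
    exact ⟨(Finset.mem_filter.1 hω).2, rfl⟩
  · calc _ ≤ ∑ y ∈ B with ¬ hcs μ Y U y u ≤ t, (2 : ℝ) ^ (-t) * pr μ {ω | U ω = u} := by
          refine Finset.sum_le_sum fun y hy => ?_
          have h := cpr_le_of_lt_hcs μ Y U (not_le.1 (Finset.mem_filter.1 hy).2)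
          rwa [cpr, div_le_iff₀ hu, Set.inter_comm] at h
      _ ≤ _ := by
          rw [Finset.sum_const, nsmul_eq_mul, mul_assoc]
          have := pr_nonneg μ {ω | U ω = u}
          gcongr
          exact Finset.filter_subset _ _

/-- Lemma `dacosupport`. -/
theorem image_size_controls_spectrum
    (𝒳 𝒴 : Type) [Fintype 𝒳] [Fintype 𝒴]
    (hX : 2 ≤ Fintype.card 𝒳) (hY : 2 ≤ Fintype.card 𝒴)
    (n : ℕ) (hn : 0 < n) (W : Channel 𝒳 𝒴)
    (Ω : Type) (μ : PMF Ω) (X : Ω → Fin n → 𝒳) (Y : Ω → Fin n → 𝒴)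
    (hout : IsOutput μ X Y W)
    (𝒰 : Type) [Fintype 𝒰] (U : Ω → 𝒰) (hmc : Markov μ U X Y)
    (u : 𝒰) (hu : 0 < pr μ {ω | U ω = u})
    (c : ℝ) (hc : 0 ≤ c) (β : ℝ) (hβ0 : 0 < β) (hβ1 : β < 1)
    (hg : (gimg W n {x | 0 < cpr μ {ω | X ω = x} {ω | U ω = u}} (1 - β) : ℝ) ≤ 2 ^ c) :
    ∀ m : ℝ, 0 < m →
      1 - 2 ^ (-m) - β ≤
        cpr μ {ω | hcs μ Y U (Y ω) (U ω) ≤ m + c} {ω | U ω = u} := by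
  intro m _
  obtain ⟨B, hB, hcard⟩ := exists_isImage_card_eq_gimg W n
    {x | 0 < cpr μ {ω | X ω = x} {ω | U ω = u}} (η := 1 - β) (by linarith)
  rw [← hcard] at hg
  have hsmall : (B.card : ℝ) * 2 ^ (-(m + c)) ≤ 2 ^ (-m) := calc
    (B.card : ℝ) * 2 ^ (-(m + c)) ≤ 2 ^ c * 2 ^ (-(m + c)) := by gcongr
    _ = 2 ^ (-m) := by
      rw [← Real.rpow_add two_pos]
      congr 1
      ring
  have hlow := hB.mul_pr_le hout hmc
  have hup := pr_inter_mem_le μ Y U hu B (m + c)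
  rw [cpr, le_div_iff₀ hu]
  linarith [mul_le_mul_of_nonneg_right hsmall hu.le]

end Paper
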